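/- For 0 < α₂ < α₁ < 1 and nonnegative integers m, l, the integral H_{m+2l}^{(m)} := ∫_{-1}^{1} C_{m+2l}^{α₂/2}(τ) C_m^{α₁/2}(τ) (1-τ²)^{(α₁-1)/2} dτ equals (√π Γ((α₁+1)/2)/Γ(α₁/2+1)) · ((α₁)_m (α₂/2)_m)/(m! (α₁/2+1)_m) · ((α₂-α₁)/2)_l ((α₂/2+m))_l / (l! (α₁/2+m+1)_l). -/

import Mathlib

open Real MeasureTheory

/-- Gegenbauer (ultraspherical) polynomial `C_n^lam` via the standard recurrence. -/
noncomputable def gegenbauer (lam : ℝ) : ℕ → ℝ → ℝ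
  | 0, _ => 1
  | 1, x => 2 * lam * x
  | (n + 2), x =>
      (2 * ((n : ℝ) + 1 + lam) * x * gegenbauer lam (n + 1) x
        - ((n : ℝ) + 2 * lam) * gegenbauer lam n x) / ((n : ℝ) + 2)


/-- Pochhammer (rising factorial) symbol `(a)_k = a(a+1)⋯(a+k-1)`. -/
noncomputable def poch (a : ℝ) (k : ℕ) : ℝ := ∏ i ∈ Finset.range k, (a + i)

lemma gegenbauer_zero (a x : ℝ) : gegenbauer a 0 x = 1 := by
  simp [gegenbauer]

lemma gegenbauer_one (a x : ℝ) : gegenbauer a 1 x = 2 * a * x := by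
  simp [gegenbauer]

lemma gegenbauer_add_two (a : ℝ) (n : ℕ) (x : ℝ) :
    ((n : ℝ) + 2) * gegenbauer a (n + 2) x =
      2 * ((n : ℝ) + 1 + a) * x * gegenbauer a (n + 1) x
        - ((n : ℝ) + 2 * a) * gegenbauer a n x := by
  have h : (n : ℝ) + 2 ≠ 0 := by positivity
  rw [gegenbauer]
  field_simp

lemma continuous_gegenbauer (a : ℝ) : ∀ n, Continuous (gegenbauer a n)
  | 0 => by
    rw [show gegenbauer a 0 = fun _ => 1 from funext (gegenbauer_zero a)]
    fun_prop
  | 1 => by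
    rw [show gegenbauer a 1 = fun x => 2 * a * x from funext (gegenbauer_one a)]
    fun_prop
  | n + 2 => by
    have h₀ := continuous_gegenbauer a n
    have h₁ := continuous_gegenbauer a (n + 1)
    rw [show gegenbauer a (n + 2) = fun x =>
      (2 * ((n : ℝ) + 1 + a) * x * gegenbauer a (n + 1) x
        - ((n : ℝ) + 2 * a) * gegenbauer a n x) / ((n : ℝ) + 2) by
      funext x; rw [gegenbauer]]
    fun_prop

lemma hasDerivAt_gegenbauer_succ (a : ℝ) {x : ℝ} (hx : 1 - x ^ 2 ≠ 0) :
    ∀ n : ℕ, HasDerivAt (gegenbauer a (n + 1))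
      ((-((n : ℝ) + 1) * x * gegenbauer a (n + 1) x + ((n : ℝ) + 2 * a) * gegenbauer a n x)
        / (1 - x ^ 2)) x
  | 0 => by
    rw [show gegenbauer a (0 + 1) = fun x => 2 * a * x from funext (gegenbauer_one a)]
    refine ((hasDerivAt_id x).const_mul (2 * a)).congr_deriv ?_
    rw [gegenbauer_zero]
    field_simp
    push_cast
    ring
  | 1 => by
    rw [show gegenbauer a (1 + 1) = fun x => 2 * a * (1 + a) * x ^ 2 - a by
      funext y
      have h := gegenbauer_add_two a 0 y
      rw [gegenbauer_zero, gegenbauer_one] at h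
      push_cast at h
      linear_combination h / 2]
    refine (((hasDerivAt_pow 2 x).const_mul (2 * a * (1 + a))).sub_const a).congr_deriv ?_
    rw [gegenbauer_one]
    field_simp
    push_cast
    ring
  | n + 2 => by
    have h₀ := hasDerivAt_gegenbauer_succ a hx n
    have h₁ := hasDerivAt_gegenbauer_succ a hx (n + 1)
    rw [show gegenbauer a (n + 2 + 1) = fun x =>
      (2 * (((n + 1 : ℕ) : ℝ) + 1 + a) * (x * gegenbauer a (n + 1 + 1) x)
        - (((n + 1 : ℕ) : ℝ) + 2 * a) * gegenbauer a (n + 1) x) / (((n + 1 : ℕ) : ℝ) + 2) by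
      funext x; rw [gegenbauer]; ring_nf]
    refine (((((hasDerivAt_id x).mul h₁).const_mul (2 * (((n + 1 : ℕ) : ℝ) + 1 + a))).sub
      (h₀.const_mul (((n + 1 : ℕ) : ℝ) + 2 * a))).div_const (((n + 1 : ℕ) : ℝ) + 2)).congr_deriv ?_
    have hn : (n : ℝ) + 1 + 2 ≠ 0 := by positivity
    have hr := gegenbauer_add_two a n x
    simp only [id, Nat.cast_add, Nat.cast_one, Nat.cast_ofNat]
    field_simp
    linear_combination -((n : ℝ) + 1 + 2 * a) * hr

lemma gegenbauer_add_two_eq_param_succ (a x : ℝ) : ∀ n : ℕ,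
    ((n : ℝ) + 2) * gegenbauer a (n + 2) x =
      2 * a * (x * gegenbauer (a + 1) (n + 1) x - gegenbauer (a + 1) n x)
  | 0 => by
    have h := gegenbauer_add_two a 0 x
    rw [h, gegenbauer_zero, gegenbauer_zero, gegenbauer_one, gegenbauer_one]
    push_cast
    ring
  | 1 => by
    have h := gegenbauer_add_two a 1 x
    have h₀ := gegenbauer_add_two a 0 x
    have h₁ := gegenbauer_add_two (a + 1) 0 x
    simp only [zero_add, gegenbauer_zero, gegenbauer_one, Nat.cast_zero, Nat.cast_one,
      Nat.reduceAdd] at h h₀ h₁ ⊢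
    linear_combination h + (2 + a) * x * h₀ - a * x * h₁
  | n + 2 => by
    have h := gegenbauer_add_two a (n + 2) x
    have i₀ := gegenbauer_add_two_eq_param_succ a x n
    have i₁ := gegenbauer_add_two_eq_param_succ a x (n + 1)
    have b₀ := gegenbauer_add_two (a + 1) n x
    have b₁ := gegenbauer_add_two (a + 1) (n + 1) x
    have hn : (n : ℝ) + 2 ≠ 0 := by positivity
    have hn' : (n : ℝ) + 3 ≠ 0 := by positivity
    rw [h]
    simp only [Nat.cast_add, Nat.cast_one, Nat.cast_ofNat, Nat.add_assoc, Nat.reduceAdd]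
      at h i₀ i₁ b₀ b₁ ⊢
    have e₀ : gegenbauer a (n + 2) x = 2 * a * (x * gegenbauer (a + 1) (n + 1) x
        - gegenbauer (a + 1) n x) / ((n : ℝ) + 2) := by
      rw [eq_div_iff hn]; linear_combination i₀
    have e₁ : gegenbauer a (n + 3) x = 2 * a * (x * gegenbauer (a + 1) (n + 2) x
        - gegenbauer (a + 1) (n + 1) x) / ((n : ℝ) + 3) := by
      rw [eq_div_iff hn']; linear_combination i₁
    have c₀ : gegenbauer (a + 1) (n + 2) x = (2 * ((n : ℝ) + 1 + (a + 1)) * x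
        * gegenbauer (a + 1) (n + 1) x - ((n : ℝ) + 2 * (a + 1)) * gegenbauer (a + 1) n x)
        / ((n : ℝ) + 2) := by
      rw [eq_div_iff hn]; linear_combination b₀
    have c₁ : gegenbauer (a + 1) (n + 3) x = (2 * ((n : ℝ) + 1 + 1 + (a + 1)) * x
        * gegenbauer (a + 1) (n + 2) x
        - ((n : ℝ) + 1 + 2 * (a + 1)) * gegenbauer (a + 1) (n + 1) x) / ((n : ℝ) + 3) := by
      rw [eq_div_iff hn']; linear_combination b₁
    rw [e₀, e₁, c₁, c₀]
    field_simp
    ring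

lemma integral_rpow_mul_one_sub_rpow {u v : ℝ} (hu : 0 < u) (hv : 0 < v) :
    ∫ t in (0 : ℝ)..1, t ^ (u - 1) * (1 - t) ^ (v - 1) =
      Gamma u * Gamma v / Gamma (u + v) := by
  have h := ProbabilityTheory.beta_eq_betaIntegralReal u v hu hv
  rw [ProbabilityTheory.beta] at h
  rw [h, Complex.betaIntegral]
  have e : ∫ x in (0 : ℝ)..1, (x : ℂ) ^ ((u : ℂ) - 1) * (1 - (x : ℂ)) ^ ((v : ℂ) - 1) =
      ∫ x in (0 : ℝ)..1, ((x ^ (u - 1) * (1 - x) ^ (v - 1) : ℝ) : ℂ) := by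
    refine intervalIntegral.integral_congr fun x hx => ?_
    rw [Set.uIcc_of_le zero_le_one] at hx
    rw [Complex.ofReal_mul, Complex.ofReal_cpow hx.1, Complex.ofReal_cpow (sub_nonneg.2 hx.2)]
    push_cast
    rfl
  rw [e, intervalIntegral.integral_ofReal, Complex.ofReal_re]

lemma integral_one_sub_sq_rpow {a : ℝ} (ha : 0 < a) :
    ∫ x in (-1 : ℝ)..1, (1 - x ^ 2) ^ (a - 1 / 2) =
      √π * Gamma (a + 1 / 2) / Gamma (a + 1) := by
  have hs := intervalIntegral.integral_comp_mul_sub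
    (f := fun x : ℝ => (1 - x ^ 2) ^ (a - 1 / 2)) (a := 0) (b := 1) (two_ne_zero' ℝ) 1
  norm_num at hs
  have e : ∫ x in (0 : ℝ)..1, (1 - (2 * x - 1) ^ 2) ^ (a - 1 / 2) =
      ∫ x in (0 : ℝ)..1, 4 ^ (a - 1 / 2) *
        (x ^ (a + 1 / 2 - 1) * (1 - x) ^ (a + 1 / 2 - 1)) := by
    refine intervalIntegral.integral_congr fun x hx => ?_
    rw [Set.uIcc_of_le zero_le_one] at hx
    rw [← mul_rpow hx.1 (sub_nonneg.2 hx.2), show a + 1 / 2 - 1 = a - 1 / 2 by ring,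
      ← mul_rpow (by norm_num) (mul_nonneg hx.1 (sub_nonneg.2 hx.2))]
    ring_nf
  rw [intervalIntegral.integral_const_mul,
    integral_rpow_mul_one_sub_rpow (by linarith) (by linarith)] at e
  have hL := Gamma_mul_Gamma_add_half (a + 1 / 2)
  rw [show a + 1 / 2 + 1 / 2 = a + 1 by ring, show 2 * (a + 1 / 2) = 2 * a + 1 by ring,
    show 1 - (2 * a + 1) = -(2 * a) by ring, rpow_neg zero_le_two] at hL
  have h4 : (4 : ℝ) ^ (a - 1 / 2) = 2 ^ (2 * a) / 2 := by
    rw [show (4 : ℝ) = 2 ^ (2 : ℝ) by norm_num, ← rpow_mul zero_le_two,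
      show 2 * (a - 1 / 2) = 2 * a - 1 by ring, rpow_sub_one two_ne_zero]
  rw [h4, show a + 1 / 2 + (a + 1 / 2) = 2 * a + 1 by ring] at e
  have g1 := (Gamma_pos_of_pos (show 0 < a + 1 by linarith)).ne'
  have g2 := (Gamma_pos_of_pos (show 0 < 2 * a + 1 by linarith)).ne'
  have h2 : (2 : ℝ) ^ (2 * a) ≠ 0 := (rpow_pos_of_pos two_pos _).ne'
  norm_num at hs e hL ⊢
  rw [e] at hs
  field_simp at hs hL ⊢
  refine mul_left_cancel₀ g2 ?_
  linear_combination Gamma ((2 * a + 1) / 2) * hL - Gamma (a + 1) * hs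

lemma intervalIntegrable_mul_one_sub_sq_rpow {a : ℝ} (ha : 0 < a) {f : ℝ → ℝ}
    (hf : Continuous f) :
    IntervalIntegrable (fun x => f x * (1 - x ^ 2) ^ (a - 1 / 2)) volume (-1) 1 := by
  have hw : IntervalIntegrable (fun x : ℝ => (1 - x ^ 2) ^ (a - 1 / 2)) volume (-1) 1 := by
    by_contra h
    have h₀ := intervalIntegral.integral_undef h
    rw [integral_one_sub_sq_rpow ha] at h₀
    have := Gamma_pos_of_pos (show 0 < a + 1 / 2 by linarith)
    have := Gamma_pos_of_pos (show 0 < a + 1 by linarith)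
    have : 0 < √π * Gamma (a + 1 / 2) / Gamma (a + 1) := by positivity
    exact this.ne' h₀
  exact hw.continuousOn_mul hf.continuousOn

lemma integral_eq_zero_of_hasDerivAt {a c : ℝ} (ha : 0 < a) {f f' g : ℝ → ℝ}
    (hf : Continuous f) (hg : Continuous g) (hc : c ≠ 0)
    (hf' : ∀ x ∈ Set.Ioo (-1 : ℝ) 1, HasDerivAt f (f' x) x)
    (h : ∀ x ∈ Set.Ioo (-1 : ℝ) 1, (1 - x ^ 2) * f' x - (2 * a + 1) * x * f x = c * g x) :
    ∫ x in (-1 : ℝ)..1, g x * (1 - x ^ 2) ^ (a - 1 / 2) = 0 := by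
  have key := intervalIntegral.integral_eq_sub_of_hasDerivAt_of_le (a := -1) (b := 1)
    (f := fun x : ℝ => (1 - x ^ 2) ^ (a + 1 / 2) * f x)
    (f' := fun x : ℝ => c * (g x * (1 - x ^ 2) ^ (a - 1 / 2))) (by norm_num) ?_ ?_ ?_
  · rw [intervalIntegral.integral_const_mul] at key
    have h0 : a + 1 / 2 ≠ 0 := by linarith
    simpa [hc, zero_rpow (show a + 2⁻¹ ≠ 0 by norm_num at h0 ⊢; exact h0)] using key
  · refine Continuous.continuousOn (Continuous.mul ?_ hf)
    exact Continuous.rpow_const (by fun_prop) fun x => Or.inr (by linarith)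
  · intro x hx
    have hx2 : 0 < 1 - x ^ 2 := by nlinarith [hx.1, hx.2]
    have h1 : HasDerivAt (fun x : ℝ => 1 - x ^ 2) (-(2 * x)) x := by
      simpa using (hasDerivAt_pow 2 x).const_sub 1
    have h2 := (h1.rpow_const (p := a + 1 / 2) (Or.inl hx2.ne')).mul (hf' x hx)
    refine h2.congr_deriv ?_
    rw [show a + 1 / 2 - 1 = a - 1 / 2 by ring,
      show a + 1 / 2 = (a - 1 / 2) + 1 by ring, rpow_add_one hx2.ne']
    linear_combination ((1 - x ^ 2) ^ (a - 1 / 2)) * h x hx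
  · exact (intervalIntegrable_mul_one_sub_sq_rpow ha hg).const_mul c

lemma integral_gegenbauer_succ {a : ℝ} (ha : 0 < a) (n : ℕ) :
    ∫ x in (-1 : ℝ)..1, gegenbauer a (n + 1) x * (1 - x ^ 2) ^ (a - 1 / 2) = 0 := by
  have hxne : ∀ x ∈ Set.Ioo (-1 : ℝ) 1, 1 - x ^ 2 ≠ 0 := fun x hx => by
    nlinarith [hx.1, hx.2]
  rcases n with _ | n
  · refine integral_eq_zero_of_hasDerivAt (c := -(2 * a + 1) / (2 * a)) (f := fun _ => 1)
      (f' := fun _ => 0) ha continuous_const (continuous_gegenbauer a _) (by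
        rw [neg_div]
        exact neg_ne_zero.2 (by positivity)) (fun x _ => hasDerivAt_const x 1) fun x _ => ?_
    rw [gegenbauer_one]
    field_simp
    ring
  · refine integral_eq_zero_of_hasDerivAt (c := -((n : ℝ) + 2 * a + 2) * (n + 2) / (2 * a)) ha
      (continuous_gegenbauer (a + 1) (n + 1)) (continuous_gegenbauer a _) (by
        rw [neg_mul, neg_div]
        exact neg_ne_zero.2 (by positivity))
      (fun x hx => hasDerivAt_gegenbauer_succ (a + 1) (hxne x hx) n) fun x hx => ?_
    have := hxne x hx
    have h := gegenbauer_add_two_eq_param_succ a x n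
    field_simp
    linear_combination ((n : ℝ) + 2 * a + 2) * h

/-- The pairing of `C_n^b` with `C_m^a` against the weight of the family `C^a`. -/
noncomputable def gegenbauerPairing (a b : ℝ) (n m : ℕ) : ℝ :=
  ∫ x in (-1 : ℝ)..1, gegenbauer b n x * gegenbauer a m x * (1 - x ^ 2) ^ (a - 1 / 2)

lemma gegenbauerPairing_zero_left {a : ℝ} (ha : 0 < a) (b : ℝ) (m : ℕ) :
    gegenbauerPairing a b 0 (m + 1) = 0 := by
  simpa only [gegenbauerPairing, gegenbauer_zero, one_mul] using integral_gegenbauer_succ ha m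

lemma integral_linear_combination_mul_weight {a : ℝ} (ha : 0 < a) {f₁ f₂ f₃ : ℝ → ℝ} (c₁ c₂ c₃ : ℝ)
    (h₁ : Continuous f₁) (h₂ : Continuous f₂) (h₃ : Continuous f₃) :
    ∫ x in (-1 : ℝ)..1, (c₁ * f₁ x + c₂ * f₂ x + c₃ * f₃ x) * (1 - x ^ 2) ^ (a - 1 / 2) =
      c₁ * (∫ x in (-1 : ℝ)..1, f₁ x * (1 - x ^ 2) ^ (a - 1 / 2)) +
      c₂ * (∫ x in (-1 : ℝ)..1, f₂ x * (1 - x ^ 2) ^ (a - 1 / 2)) +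
      c₃ * (∫ x in (-1 : ℝ)..1, f₃ x * (1 - x ^ 2) ^ (a - 1 / 2)) := by
  have i₁ := (intervalIntegrable_mul_one_sub_sq_rpow ha h₁).const_mul c₁
  have i₂ := (intervalIntegrable_mul_one_sub_sq_rpow ha h₂).const_mul c₂
  have i₃ := (intervalIntegrable_mul_one_sub_sq_rpow ha h₃).const_mul c₃
  simp only [← intervalIntegral.integral_const_mul]
  rw [← intervalIntegral.integral_add i₁ i₂, ← intervalIntegral.integral_add (i₁.add i₂) i₃]
  congr 1 with x
  ring

lemma gegenbauerPairing_one_zero {a : ℝ} (ha : 0 < a) (b : ℝ) :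
    gegenbauerPairing a b 1 0 = 0 := by
  have h := integral_gegenbauer_succ ha 0
  have e : gegenbauerPairing a b 1 0 = ∫ x in (-1 : ℝ)..1,
      b / a * (gegenbauer a (0 + 1) x * (1 - x ^ 2) ^ (a - 1 / 2)) := by
    rw [gegenbauerPairing]
    congr 1 with x
    rw [gegenbauer_zero, gegenbauer_one, gegenbauer_one]
    field_simp
  rw [e, intervalIntegral.integral_const_mul, h, mul_zero]

lemma gegenbauerPairing_one_succ {a : ℝ} (ha : 0 < a) (b : ℝ) (m : ℕ) :
    gegenbauerPairing a b 1 (m + 1) =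
      b * (m + 2 * a) / (m + 1 + a) * gegenbauerPairing a b 0 m := by
  have hm : (m : ℝ) + 1 + a ≠ 0 := by positivity
  have h := integral_linear_combination_mul_weight ha (b * (m + 2) / (m + 1 + a))
    (b * (m + 2 * a) / (m + 1 + a)) 0 (continuous_gegenbauer a (m + 2))
    (continuous_gegenbauer a m) (continuous_gegenbauer a m)
  rw [integral_gegenbauer_succ ha, mul_zero, zero_add, zero_mul, add_zero] at h
  simp only [gegenbauerPairing, gegenbauer_zero, gegenbauer_one, one_mul]
  rw [← h]
  congr 1 with x
  have := gegenbauer_add_two a m x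
  congr 1
  field_simp
  linear_combination -b * this

lemma gegenbauerPairing_add_two_zero {a : ℝ} (ha : 0 < a) (b : ℝ) (n : ℕ) :
    ((n : ℝ) + 2) * gegenbauerPairing a b (n + 2) 0 =
      (n + 1 + b) / a * gegenbauerPairing a b (n + 1) 1
        - (n + 2 * b) * gegenbauerPairing a b n 0 := by
  have h := integral_linear_combination_mul_weight ha ((n + 1 + b) / a) (-(n + 2 * b)) 0
    ((continuous_gegenbauer b (n + 1)).mul (continuous_gegenbauer a 1))
    ((continuous_gegenbauer b n).mul (continuous_gegenbauer a 0))
    (continuous_gegenbauer b n)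
  rw [zero_mul, add_zero] at h
  simp only [gegenbauerPairing]
  rw [← intervalIntegral.integral_const_mul]
  refine Eq.trans ?_ (h.trans (by simp only [Pi.mul_apply]; ring))
  congr 1 with x
  have := gegenbauer_add_two b n x
  simp only [Pi.mul_apply, gegenbauer_zero, gegenbauer_one]
  rw [← mul_assoc, ← mul_assoc, this]
  congr 1
  field_simp
  ring

lemma gegenbauerPairing_add_two_succ {a : ℝ} (ha : 0 < a) (b : ℝ) (n m : ℕ) :
    ((n : ℝ) + 2) * gegenbauerPairing a b (n + 2) (m + 1) =
      (n + 1 + b) * (m + 2) / (m + 1 + a) * gegenbauerPairing a b (n + 1) (m + 2)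
        + (n + 1 + b) * (m + 2 * a) / (m + 1 + a) * gegenbauerPairing a b (n + 1) m
        - (n + 2 * b) * gegenbauerPairing a b n (m + 1) := by
  have hm : (m : ℝ) + 1 + a ≠ 0 := by positivity
  have h := integral_linear_combination_mul_weight ha ((n + 1 + b) * (m + 2) / (m + 1 + a))
    ((n + 1 + b) * (m + 2 * a) / (m + 1 + a)) (-(n + 2 * b))
    ((continuous_gegenbauer b (n + 1)).mul (continuous_gegenbauer a (m + 2)))
    ((continuous_gegenbauer b (n + 1)).mul (continuous_gegenbauer a m))
    ((continuous_gegenbauer b n).mul (continuous_gegenbauer a (m + 1)))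
  simp only [gegenbauerPairing]
  rw [← intervalIntegral.integral_const_mul]
  refine Eq.trans ?_ (h.trans (by simp only [Pi.mul_apply]; ring))
  congr 1 with x
  have hb := gegenbauer_add_two b n x
  have hc := gegenbauer_add_two a m x
  simp only [Pi.mul_apply]
  rw [← mul_assoc, ← mul_assoc, hb]
  congr 1
  field_simp
  linear_combination -(n + 1 + b) * gegenbauer b (n + 1) x * hc

lemma gegenbauerPairing_eq_zero {a : ℝ} (ha : 0 < a) (b : ℝ) :
    ∀ n m : ℕ, (∀ l, n ≠ m + 2 * l) → gegenbauerPairing a b n m = 0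
  | 0, 0, h => absurd rfl (h 0)
  | 0, m + 1, _ => gegenbauerPairing_zero_left ha b m
  | 1, 0, _ => gegenbauerPairing_one_zero ha b
  | 1, 1, h => absurd rfl (h 0)
  | 1, m + 2, _ => by
    rw [gegenbauerPairing_one_succ ha, gegenbauerPairing_zero_left ha, mul_zero]
  | n + 2, 0, h => by
    have hn : (n : ℝ) + 2 ≠ 0 := by positivity
    have e := gegenbauerPairing_add_two_zero ha b n
    rw [gegenbauerPairing_eq_zero ha b (n + 1) 1 fun l hl => h (l + 1) (by omega),
      gegenbauerPairing_eq_zero ha b n 0 fun l hl => h (l + 1) (by omega)] at e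
    simpa [hn] using e
  | n + 2, m + 1, h => by
    have hn : (n : ℝ) + 2 ≠ 0 := by positivity
    have e := gegenbauerPairing_add_two_succ ha b n m
    rw [gegenbauerPairing_eq_zero ha b (n + 1) (m + 2) fun l hl => h (l + 1) (by omega),
      gegenbauerPairing_eq_zero ha b (n + 1) m fun l hl => h l (by omega),
      gegenbauerPairing_eq_zero ha b n (m + 1) fun l hl => h (l + 1) (by omega)] at e
    simpa [hn] using e

lemma poch_zero (a : ℝ) : poch a 0 = 1 := by simp [poch]

lemma poch_succ (a : ℝ) (k : ℕ) : poch a (k + 1) = poch a k * (a + k) := by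
  simp [poch, Finset.prod_range_succ]

lemma poch_add (a : ℝ) (m k : ℕ) : poch a (m + k) = poch a m * poch (a + m) k := by
  simp [poch, Finset.prod_range_add, add_assoc]

lemma poch_pos {a : ℝ} (ha : 0 < a) (k : ℕ) : 0 < poch a k :=
  Finset.prod_pos fun i _ => by positivity

lemma gegenbauerPairing_add_two_mul {a : ℝ} (ha : 0 < a) (b : ℝ) :
    ∀ n m l : ℕ, n = m + 2 * l → gegenbauerPairing a b n m =
      gegenbauerPairing a b 0 0 * (poch (2 * a) m / m.factorial) *
        (poch b (m + l) / poch (a + 1) (m + l)) * (poch (b - a) l / l.factorial)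
  | 0, 0, 0, _ => by simp [poch_zero]
  | 0, m + 1, l, h => by omega
  | 1, 0, l, h => by omega
  | 1, m + 2, l, h => by omega
  | 1, 1, 0, _ => by
    rw [gegenbauerPairing_one_succ ha]
    simp only [poch_succ, poch_zero, add_zero, Nat.factorial]
    push_cast
    field_simp
    ring
  | n + 2, 0, l + 1, h => by
    obtain rfl : n = 2 * l := by omega
    have e := gegenbauerPairing_add_two_zero ha b (2 * l)
    rw [gegenbauerPairing_add_two_mul ha b (2 * l + 1) 1 l (by omega),
      gegenbauerPairing_add_two_mul ha b (2 * l) 0 l (by omega)] at e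
    have hp := (poch_pos (show 0 < a + 1 by positivity) l).ne'
    have hn : ((2 * l : ℕ) : ℝ) + 2 ≠ 0 := by positivity
    apply mul_left_cancel₀ hn
    rw [e]
    simp only [add_comm 1 l, zero_add, poch_succ, poch_zero, Nat.factorial_succ,
      Nat.factorial_zero]
    push_cast
    have : a + 1 + l ≠ 0 := by positivity
    field_simp
    ring
  | n + 2, m + 1, 0, h => by
    obtain rfl : n + 1 = m := by omega
    have e := gegenbauerPairing_add_two_succ ha b n (n + 1)
    rw [gegenbauerPairing_eq_zero ha b (n + 1) (n + 1 + 2) fun l hl => by omega,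
      gegenbauerPairing_add_two_mul ha b (n + 1) (n + 1) 0 (by omega),
      gegenbauerPairing_eq_zero ha b n (n + 1 + 1) fun l hl => by omega] at e
    have hp := (poch_pos (show 0 < a + 1 by positivity) n).ne'
    have hn : (n : ℝ) + 2 ≠ 0 := by positivity
    apply mul_left_cancel₀ hn
    rw [e]
    simp only [add_zero, poch_succ, poch_zero, Nat.factorial_succ]
    push_cast
    have : a + 1 + n ≠ 0 := by positivity
    have : a + 1 + (n + 1) ≠ 0 := by positivity
    field_simp
    ring
  | n + 2, m + 1, l + 1, h => by
    obtain rfl : n = m + 1 + 2 * l := by omega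
    have e := gegenbauerPairing_add_two_succ ha b (m + 1 + 2 * l) m
    rw [gegenbauerPairing_add_two_mul ha b (m + 1 + 2 * l + 1) (m + 2) l (by omega),
      gegenbauerPairing_add_two_mul ha b (m + 1 + 2 * l + 1) m (l + 1) (by omega),
      gegenbauerPairing_add_two_mul ha b (m + 1 + 2 * l) (m + 1) l (by omega)] at e
    have hp := (poch_pos (show 0 < a + 1 by positivity) (m + l)).ne'
    have hn : ((m + 1 + 2 * l : ℕ) : ℝ) + 2 ≠ 0 := by positivity
    apply mul_left_cancel₀ hn
    rw [e]
    simp only [show m + 2 + l = m + l + 1 + 1 by omega, show m + (l + 1) = m + l + 1 by omega,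
      show m + 1 + l = m + l + 1 by omega, show m + 1 + (l + 1) = m + l + 1 + 1 by omega,
      show m + 2 = m + 1 + 1 by omega, poch_succ, Nat.factorial_succ]
    push_cast
    have : a + 1 + (m + l) ≠ 0 := by positivity
    have : a + 1 + (m + l + 1) ≠ 0 := by positivity
    field_simp
    ring


theorem stmt5 (α₁ α₂ : ℝ) (h0 : 0 < α₂) (h12 : α₂ < α₁) (h1 : α₁ < 1) (m l : ℕ) :
    (∫ τ in (-1 : ℝ)..1,
      gegenbauer (α₂ / 2) (m + 2 * l) τ * gegenbauer (α₁ / 2) m τ *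
        (1 - τ ^ 2) ^ ((α₁ - 1) / 2)) =
      (Real.sqrt π * Real.Gamma ((α₁ + 1) / 2) / Real.Gamma (α₁ / 2 + 1)) *
        (poch α₁ m * poch (α₂ / 2) m / ((m.factorial : ℝ) * poch (α₁ / 2 + 1) m)) *
        (poch ((α₂ - α₁) / 2) l * poch (α₂ / 2 + m) l /
          ((l.factorial : ℝ) * poch (α₁ / 2 + m + 1) l)) := by
  have ha : 0 < α₁ / 2 := by linarith
  have h := gegenbauerPairing_add_two_mul ha (α₂ / 2) (m + 2 * l) m l rfl
  have h00 : gegenbauerPairing (α₁ / 2) (α₂ / 2) 0 0 =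
      √π * Gamma (α₁ / 2 + 1 / 2) / Gamma (α₁ / 2 + 1) := by
    simpa only [gegenbauerPairing, gegenbauer_zero, one_mul] using integral_one_sub_sq_rpow ha
  rw [h00, gegenbauerPairing, poch_add, poch_add, show α₁ / 2 - 1 / 2 = (α₁ - 1) / 2 by ring,
    show α₁ / 2 + 1 / 2 = (α₁ + 1) / 2 by ring, show α₂ / 2 - α₁ / 2 = (α₂ - α₁) / 2 by ring,
    show 2 * (α₁ / 2) = α₁ by ring, show α₁ / 2 + 1 + (m : ℝ) = α₁ / 2 + m + 1 by ring] at h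
  rw [h]
  simp only [div_eq_mul_inv, mul_inv]
  ring
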